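/- Let d₁,…,d_p ∈ ℝ^p and let w₁,…,w_p > 0 be positive weights such that Σ_{i=1}^p w_i d_i d_iᵀ = I_p. Then the vectors d₁,…,d_p are pairwise orthogonal, and ‖d_j‖₂² = 1/w_j for every j ∈ {1,…,p}. -/

import Mathlib

open Matrix Finset

/-- If `Σᵢ wᵢ dᵢ dᵢᵀ = I_p` with positive weights and exactly `p` vectors in `ℝ^p`,
then the `dᵢ` are pairwise orthogonal and `‖d_j‖₂² = 1 / w_j`. -/
theorem weighted_identity_decomposition_orthogonal
    (p : ℕ) (d : Fin p → Fin p → ℝ) (w : Fin p → ℝ) (hw : ∀ i, 0 < w i)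
    (hdecomp : ∑ i, w i • Matrix.vecMulVec (d i) (d i) =
      (1 : Matrix (Fin p) (Fin p) ℝ)) :
    (∀ i j, i ≠ j → d i ⬝ᵥ d j = 0) ∧ (∀ j, d j ⬝ᵥ d j = 1 / w j) := by
  have h1 : (Matrix.of fun k i => w i * d i k) * (Matrix.of d) =
      (1 : Matrix (Fin p) (Fin p) ℝ) := by
    rw [← hdecomp]
    ext a b
    simp [Matrix.mul_apply, Matrix.sum_apply, Matrix.vecMulVec_apply, mul_assoc]
  have h2 := mul_eq_one_comm.mp h1
  have h3 : ∀ i j, w j * (d i ⬝ᵥ d j) = (1 : Matrix (Fin p) (Fin p) ℝ) i j := by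
    intro i j
    rw [← h2]
    simp only [Matrix.mul_apply, Matrix.of_apply, dotProduct, Finset.mul_sum]
    exact Finset.sum_congr rfl fun k _ => by ring
  refine ⟨fun i j hij => ?_, fun j => ?_⟩
  · have h := h3 i j
    rw [Matrix.one_apply_ne hij] at h
    exact (mul_eq_zero.mp h).resolve_left (hw j).ne'
  · have h := h3 j j
    rw [Matrix.one_apply_eq] at h
    rw [eq_div_iff (hw j).ne', mul_comm]
    exact h
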